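/- Let π(G,r) denote the minimum k such that r is reachable under every pebble distribution of size k on G, and let H be the graph consisting of α ≥ 1 disjoint copies of a connected graph G identified at the single vertex r. If a distribution q on H restricts to the same distribution p of size k on each copy of G (with q(r) = p(r) in the shared vertex, counting once), and r is reachable in H under q, then r is reachable in G under p. -/

import Mathlib

variable {V : Type*} [DecidableEq V]

/-- Result of a pebbling move `u → v`: remove two pebbles from `u`, add one to `v`. -/
def applyMove (p : V → ℕ) (u v : V) (x : V) : ℕ :=
  (if x = u then p x - 2 else p x) + (if x = v then 1 else 0)

/-- A list of moves is a valid sequence of pebbling moves from `p` in `G`. -/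
def IsValidSeq (G : SimpleGraph V) : (V → ℕ) → List (V × V) → Prop
  | _, [] => True
  | p, m :: rest => G.Adj m.1 m.2 ∧ 2 ≤ p m.1 ∧ IsValidSeq G (applyMove p m.1 m.2) rest

/-- The distribution after executing a sequence of pebbling moves. -/
def applySeq (p : V → ℕ) : List (V × V) → V → ℕ
  | [] => p
  | m :: rest => applySeq (applyMove p m.1 m.2) rest

/-- Indegree of a vertex in a directed multigraph (multiset of directed edges). -/
def indeg (D : Multiset (V × V)) (v : V) : ℕ :=
  Multiset.card (D.filter fun e => e.2 = v)

/-- Outdegree of a vertex in a directed multigraph. -/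
def outdeg (D : Multiset (V × V)) (v : V) : ℕ :=
  Multiset.card (D.filter fun e => e.1 = v)

/-- balance(D,p,v) = p(v) + indeg_D(v) - 2·outdeg_D(v). -/
def balance (D : Multiset (V × V)) (p : V → ℕ) (v : V) : ℤ :=
  (p v : ℤ) + (indeg D v : ℤ) - 2 * (outdeg D v : ℤ)

/-- `D` is orderable under `p`: some ordering of the edge multiset of `D`
is a valid sequence of pebbling moves. -/
def Orderable (G : SimpleGraph V) (D : Multiset (V × V)) (p : V → ℕ) : Prop :=
  ∃ σ : List (V × V), (σ : Multiset (V × V)) = D ∧ IsValidSeq G p σ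

/-- A directed multigraph is acyclic if its edge relation admits no directed cycle. -/
def DAcyclic (D : Multiset (V × V)) : Prop :=
  ∀ v : V, ¬ Relation.TransGen (fun a b => (a, b) ∈ D) v v

/-- The strongly connected component of `a` in the directed multigraph `D`. -/
def SCC (D : Multiset (V × V)) (a : V) : Set V :=
  {b | Relation.ReflTransGen (fun x y => (x, y) ∈ D) a b ∧
       Relation.ReflTransGen (fun x y => (x, y) ∈ D) b a}

/-- `α` disjoint copies of `G` glued at the vertex `r`: `none` is the shared copy of `r`,
and `some (j, x)` is the copy of `x ≠ r` in the `j`-th copy of `G`. -/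
def glueCopies (G : SimpleGraph V) (r : V) (α : ℕ) :
    SimpleGraph (Option (Fin α × {x : V // x ≠ r})) :=
  SimpleGraph.fromRel (fun a b =>
    match a, b with
    | none, some (_, x) => G.Adj r x.val
    | some (j, x), some (j', x') => j = j' ∧ G.Adj x.val x'.val
    | _, _ => False)

/-- The distribution on the `j`-th copy of `G` (with no pebbles on `r`). -/
def copyDist (r : V) {α : ℕ} (q : Option (Fin α × {x : V // x ≠ r}) → ℕ) (j : Fin α) (x : V) : ℕ :=
  if hx : x ≠ r then q (some (j, ⟨x, hx⟩)) else 0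

/-- If the shared vertex starts empty and gets a pebble, then some single copy suffices. -/
theorem exists_copy (G : SimpleGraph V) (r : V) (α : ℕ)
    (σ : List (Option (Fin α × {x : V // x ≠ r}) × Option (Fin α × {x : V // x ≠ r}))) :
    ∀ q : Option (Fin α × {x : V // x ≠ r}) → ℕ, q none = 0 →
      IsValidSeq (glueCopies G r α) q σ → 1 ≤ applySeq q σ none →
      ∃ (j : Fin α) (τ : List (V × V)), IsValidSeq G (copyDist r q j) τ ∧
        1 ≤ applySeq (copyDist r q j) τ r := by
  induction σ with
  | nil => intro q h0 _ h; simp [applySeq, h0] at h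
  | cons m σ ih =>
    intro q h0 hv h
    obtain ⟨a, b⟩ := m
    obtain ⟨hadj, h2, hv⟩ := hv
    simp only at hadj h2 hv
    simp only [applySeq] at h
    rcases a with _ | ⟨j, x, hx⟩
    · omega
    rcases b with _ | ⟨j', y, hy⟩
    · have hG : G.Adj x r := by
        simpa [glueCopies, SimpleGraph.fromRel_adj, G.adj_comm] using hadj
      refine ⟨j, [(x, r)], ⟨hG, ?_, trivial⟩, ?_⟩
      · simpa [copyDist, hx] using h2
      · simp [applySeq, applyMove]
    · have hG : j = j' ∧ G.Adj x y := by
        simp only [glueCopies, SimpleGraph.fromRel_adj] at hadj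
        rcases hadj.2 with h | h
        · exact h
        · exact ⟨h.1.symm, h.2.symm⟩
      obtain ⟨rfl, hG⟩ := hG
      obtain ⟨i, τ, hτ, hr⟩ := ih _ (by simp [applyMove, h0]) hv h
      by_cases hij : i = j
      · subst hij
        have e : copyDist r (applyMove q (some (i, ⟨x, hx⟩)) (some (i, ⟨y, hy⟩))) i
            = applyMove (copyDist r q i) x y := by
          funext z
          by_cases hz : z = r
          · subst hz
            simp [copyDist, applyMove, hx.symm, hy.symm]
          · simp [copyDist, applyMove, hz]
        rw [e] at hτ hr
        refine ⟨i, (x, y) :: τ, ⟨hG, ?_, hτ⟩, hr⟩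
        simpa [copyDist, hx] using h2
      · have e : copyDist r (applyMove q (some (j, ⟨x, hx⟩)) (some (j, ⟨y, hy⟩))) i
            = copyDist r q i := by
          funext z
          simp [copyDist, applyMove, hij]
        rw [e] at hτ hr
        exact ⟨i, τ, hτ, hr⟩

/-- If `r` is reachable in the graph `H` made of `α` copies of a connected graph `G`
sharing the vertex `r`, under the distribution restricting to `p` on each copy,
then `r` is reachable in `G` under `p`. -/
theorem copies_glued_reachable (G : SimpleGraph V) (hG : G.Connected) (r : V)
    (α : ℕ) (hα : 1 ≤ α) (p : V → ℕ)
    (h : ∃ σ : List (Option (Fin α × {x : V // x ≠ r}) × Option (Fin α × {x : V // x ≠ r})),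
      IsValidSeq (glueCopies G r α)
        (fun x => match x with | none => p r | some (_, y) => p y.val) σ ∧
      1 ≤ applySeq (fun x => match x with | none => p r | some (_, y) => p y.val) σ none) :
    ∃ τ : List (V × V), IsValidSeq G p τ ∧ 1 ≤ applySeq p τ r := by
  obtain ⟨σ, hv, h1⟩ := h
  by_cases hp : p r = 0
  · obtain ⟨j, τ, hτ, hr⟩ := exists_copy G r α σ _ hp hv h1
    have e : copyDist r (fun x : Option (Fin α × {x : V // x ≠ r}) =>
        match x with | none => p r | some (_, y) => p y.val) j = p := by
      funext z
      by_cases hz : z = r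
      · subst hz; simp [copyDist, hp]
      · simp [copyDist, hz]
    rw [e] at hτ hr
    exact ⟨τ, hτ, hr⟩
  · exact ⟨[], trivial, Nat.one_le_iff_ne_zero.mpr hp⟩
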